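/- Let (g, Φ = (D, θ), ⟨·,·⟩) be an extrinsic symmetric triple with n = dim g₋⁻ ≥ 1 and let h be its mean curvature vector. Then [X, h] = 0 for every X ∈ g⁺ = ker D; in other words, h centralizes the whole (+1)-eigenspace of τ = id + 2D². -/

import Mathlib

/-- The span of all brackets `⁅u, v⁆` with `u ∈ U`, `v ∈ V`. -/
def bracketSpan {L : Type} [LieRing L] [LieAlgebra ℝ L]
    (U V : Submodule ℝ L) : Submodule ℝ L :=
  Submodule.span ℝ {z | ∃ u ∈ U, ∃ v ∈ V, z = ⁅u, v⁆}

/-- An extrinsic symmetric triple `(g, (D, θ), ⟨·,·⟩)`: a metric Lie algebra with an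
invariant nondegenerate symmetric bilinear form, an isometric involutive automorphism `θ`,
and an antisymmetric derivation `D` with `D³ = -D`, `Dθ = -θD` and `g₊⁺ = [g₊⁻, g₊⁻]`. -/
structure ExtSymTriple (L : Type) [LieRing L] [LieAlgebra ℝ L] [Module.Finite ℝ L] where
  B : LinearMap.BilinForm ℝ L
  Bsymm : ∀ x y, B x y = B y x
  Binv : ∀ x y z, B ⁅x, y⁆ z = B x ⁅y, z⁆
  Bnondeg : B.Nondegenerate
  theta : L →ₗ[ℝ] L
  thetaLie : ∀ x y, theta ⁅x, y⁆ = ⁅theta x, theta y⁆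
  thetaInvol : ∀ x, theta (theta x) = x
  thetaIso : ∀ x y, B (theta x) (theta y) = B x y
  D : L →ₗ[ℝ] L
  Dder : ∀ x y, D ⁅x, y⁆ = ⁅D x, y⁆ + ⁅x, D y⁆
  Danti : ∀ x y, B (D x) y = - B x (D y)
  D3 : ∀ x, D (D (D x)) = - D x
  Dtheta : ∀ x, D (theta x) = - theta (D x)
  cartan : (LinearMap.ker (theta - LinearMap.id) ⊓ LinearMap.ker D) =
    bracketSpan
      (LinearMap.ker (theta - LinearMap.id) ⊓ LinearMap.ker (D ∘ₗ D + LinearMap.id))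
      (LinearMap.ker (theta - LinearMap.id) ⊓ LinearMap.ker (D ∘ₗ D + LinearMap.id))

namespace ExtSymTriple

variable {L : Type} [LieRing L] [LieAlgebra ℝ L] [Module.Finite ℝ L] (T : ExtSymTriple L)

/-- `g₊⁺ = g₊ ∩ g⁺`. -/
def gPlusUp : Submodule ℝ L :=
  LinearMap.ker (T.theta - LinearMap.id) ⊓ LinearMap.ker T.D

/-- `g₊⁻ = g₊ ∩ g⁻`. -/
def gPlusDown : Submodule ℝ L :=
  LinearMap.ker (T.theta - LinearMap.id) ⊓ LinearMap.ker (T.D ∘ₗ T.D + LinearMap.id)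

/-- `g₋⁺ = g₋ ∩ g⁺`. -/
def gMinusUp : Submodule ℝ L :=
  LinearMap.ker (T.theta + LinearMap.id) ⊓ LinearMap.ker T.D

/-- `g₋⁻ = g₋ ∩ g⁻`. -/
def gMinusDown : Submodule ℝ L :=
  LinearMap.ker (T.theta + LinearMap.id) ⊓ LinearMap.ker (T.D ∘ₗ T.D + LinearMap.id)

/-- Indecomposability: `g` is not the direct sum of two nonzero ideals that are orthogonal
to each other and invariant under `θ` and `D`. -/
def Indecomposable : Prop :=
  ¬ ∃ I J : LieIdeal ℝ L, I ≠ ⊥ ∧ J ≠ ⊥ ∧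
    (I : Submodule ℝ L) ⊓ (J : Submodule ℝ L) = ⊥ ∧
    (I : Submodule ℝ L) ⊔ (J : Submodule ℝ L) = ⊤ ∧
    (∀ x ∈ I, ∀ y ∈ J, T.B x y = 0) ∧
    (∀ x ∈ I, T.theta x ∈ I) ∧ (∀ x ∈ I, T.D x ∈ I) ∧
    (∀ x ∈ J, T.theta x ∈ J) ∧ (∀ x ∈ J, T.D x ∈ J)

end ExtSymTriple

/-- Expansion of a vector in an orthonormal family whose members have square `κ j = ±1`. -/
theorem sum_smul_eq_of_mem_span_orthonormal {V : Type*} [AddCommGroup V] [Module ℝ V]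
    {ι : Type*} [Fintype ι] (B : LinearMap.BilinForm ℝ V) (e : ι → V) (κ : ι → ℝ)
    (horth : ∀ i j, i ≠ j → B (e i) (e j) = 0) (hκ : ∀ j, B (e j) (e j) = κ j)
    (hκ1 : ∀ j, κ j = 1 ∨ κ j = -1) {v : V} (hv : v ∈ Submodule.span ℝ (Set.range e)) :
    ∑ k, (κ k * B v (e k)) • e k = v := by
  induction hv using Submodule.span_induction with
  | mem x hx =>
    obtain ⟨i, rfl⟩ := hx
    rw [Finset.sum_eq_single i]
    · rw [hκ]
      rcases hκ1 i with h | h <;> simp [h]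
    · intro k _ hk
      simp [horth i k hk.symm]
    · simp
  | zero => simp
  | add x y _ _ hx hy =>
    simp only [map_add, LinearMap.add_apply, mul_add, add_smul, Finset.sum_add_distrib, hx, hy]
  | smul a x _ hx =>
    conv_rhs => rw [← hx]
    simp only [map_smul, LinearMap.smul_apply, smul_eq_mul, Finset.smul_sum, smul_smul,
      mul_left_comm]

/-- The trace of a bilinear map over an orthonormal family moves an operator to its adjoint. -/
theorem sum_bilin_adjoint_of_orthonormal {V W : Type*} [AddCommGroup V] [Module ℝ V]
    [AddCommGroup W] [Module ℝ W] {ι : Type*} [Fintype ι] (B : LinearMap.BilinForm ℝ V)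
    (hB : ∀ x y, B x y = B y x) (e : ι → V) (κ : ι → ℝ)
    (horth : ∀ i j, i ≠ j → B (e i) (e j) = 0) (hκ : ∀ j, B (e j) (e j) = κ j)
    (hκ1 : ∀ j, κ j = 1 ∨ κ j = -1) (F : V →ₗ[ℝ] V →ₗ[ℝ] W) (p q : ι → V)
    (hp : ∀ j, p j ∈ Submodule.span ℝ (Set.range e))
    (hq : ∀ j, q j ∈ Submodule.span ℝ (Set.range e))
    (hpq : ∀ j k, B (p j) (e k) = B (e j) (q k)) :
    ∑ j, κ j • F (p j) (e j) = ∑ j, κ j • F (e j) (q j) := by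
  have hL (j : ι) : κ j • F (p j) (e j) =
      ∑ k, (κ j * (κ k * B (p j) (e k))) • F (e k) (e j) := by
    conv_lhs => rw [← sum_smul_eq_of_mem_span_orthonormal B e κ horth hκ hκ1 (hp j)]
    simp only [map_sum, map_smul, LinearMap.sum_apply, LinearMap.smul_apply, Finset.smul_sum,
      smul_smul]
  have hR (j : ι) : κ j • F (e j) (q j) =
      ∑ k, (κ j * (κ k * B (q j) (e k))) • F (e j) (e k) := by
    conv_lhs => rw [← sum_smul_eq_of_mem_span_orthonormal B e κ horth hκ hκ1 (hq j)]
    simp only [map_sum, map_smul, Finset.smul_sum, smul_smul]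
  simp only [hL, hR]
  rw [Finset.sum_comm]
  refine Finset.sum_congr rfl fun j _ => Finset.sum_congr rfl fun k _ => ?_
  rw [hpq, hB (e k), mul_left_comm]

namespace ExtSymTriple

variable {L : Type} [LieRing L] [LieAlgebra ℝ L] [Module.Finite ℝ L] (T : ExtSymTriple L)

theorem mem_gMinusDown {x : L} : x ∈ T.gMinusDown ↔ T.theta x = -x ∧ T.D (T.D x) = -x := by
  simp [gMinusDown, eq_neg_iff_add_eq_zero]

theorem D_lie_of_D_eq_zero {X : L} (hX : T.D X = 0) (y : L) : T.D ⁅X, y⁆ = ⁅X, T.D y⁆ := by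
  rw [T.Dder, hX, zero_lie, zero_add]

theorem B_lie_left (X y z : L) : T.B ⁅X, y⁆ z = -T.B y ⁅X, z⁆ := by
  rw [← lie_skew, map_neg, LinearMap.neg_apply, T.Binv]

theorem lie_mem_gMinusDown {X y : L} (hX : T.D X = 0) (hθ : T.theta X = X)
    (hy : y ∈ T.gMinusDown) : ⁅X, y⁆ ∈ T.gMinusDown := by
  rw [mem_gMinusDown] at hy ⊢
  rw [T.thetaLie, hθ, hy.1, T.D_lie_of_D_eq_zero hX, T.D_lie_of_D_eq_zero hX, hy.2, lie_neg]
  exact ⟨rfl, rfl⟩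

theorem D_lie_mem_gMinusDown {X y : L} (hθ : T.theta X = -X)
    (hy : y ∈ T.gMinusDown) : T.D ⁅X, y⁆ ∈ T.gMinusDown := by
  rw [mem_gMinusDown] at hy ⊢
  refine ⟨?_, T.D3 _⟩
  rw [← neg_eq_iff_eq_neg, ← T.Dtheta, T.thetaLie, hθ, hy.1, neg_lie, lie_neg, neg_neg]

section MeanCurvature

variable {ι : Type*} [Fintype ι] {e : ι → L} {κ : ι → ℝ}

theorem lie_sum_eq_zero_of_theta_eq (hmem : ∀ j, e j ∈ T.gMinusDown)
    (hspan : ∀ x ∈ T.gMinusDown, x ∈ Submodule.span ℝ (Set.range e))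
    (horth : ∀ i j, i ≠ j → T.B (e i) (e j) = 0) (hκ : ∀ j, T.B (e j) (e j) = κ j)
    (hκ1 : ∀ j, κ j = 1 ∨ κ j = -1) {X : L} (hX : T.D X = 0) (hθ : T.theta X = X) :
    ⁅X, ∑ j, κ j • ⁅T.D (e j), e j⁆⁆ = 0 := by
  have key := sum_bilin_adjoint_of_orthonormal T.B T.Bsymm e κ horth hκ hκ1
    ((LieAlgebra.ad ℝ L : L →ₗ[ℝ] Module.End ℝ L) ∘ₗ T.D)
    (fun j => ⁅X, e j⁆) (fun j => -⁅X, e j⁆)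
    (fun j => hspan _ (T.lie_mem_gMinusDown hX hθ (hmem j)))
    (fun j => neg_mem (hspan _ (T.lie_mem_gMinusDown hX hθ (hmem j))))
    (fun j k => by rw [T.B_lie_left, map_neg])
  simp only [LinearMap.comp_apply, LieHom.coe_toLinearMap, LieAlgebra.ad_apply, lie_neg, smul_neg,
    Finset.sum_neg_distrib, T.D_lie_of_D_eq_zero hX] at key
  simp only [lie_sum, lie_smul, leibniz_lie X, smul_add, Finset.sum_add_distrib]
  rw [key, neg_add_cancel]

theorem lie_sum_eq_zero_of_theta_eq_neg (hmem : ∀ j, e j ∈ T.gMinusDown)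
    (hspan : ∀ x ∈ T.gMinusDown, x ∈ Submodule.span ℝ (Set.range e))
    (horth : ∀ i j, i ≠ j → T.B (e i) (e j) = 0) (hκ : ∀ j, T.B (e j) (e j) = κ j)
    (hκ1 : ∀ j, κ j = 1 ∨ κ j = -1) {X : L} (hX : T.D X = 0) (hθ : T.theta X = -X) :
    ⁅X, ∑ j, κ j • ⁅T.D (e j), e j⁆⁆ = 0 := by
  have hA (j : ι) := hspan _ (T.D_lie_mem_gMinusDown hθ (hmem j))
  have hsymm (j k : ι) : T.B (T.D ⁅X, e j⁆) (e k) = T.B (e j) (T.D ⁅X, e k⁆) := by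
    rw [T.Danti, T.B_lie_left, neg_neg, T.D_lie_of_D_eq_zero hX]
  have key (F : L →ₗ[ℝ] L →ₗ[ℝ] L) := sum_bilin_adjoint_of_orthonormal T.B T.Bsymm e κ horth hκ
    hκ1 F (fun j => T.D ⁅X, e j⁆) (fun j => T.D ⁅X, e j⁆) hA hA hsymm
  have hswap (a b : ι → L) : ∑ j, κ j • ⁅a j, b j⁆ = -∑ j, κ j • ⁅b j, a j⁆ := by
    simp only [← Finset.sum_neg_distrib, ← smul_neg, lie_skew]
  have h1 : ∑ j, κ j • ⁅T.D ⁅X, e j⁆, e j⁆ = 0 := by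
    have := key (LieAlgebra.ad ℝ L : L →ₗ[ℝ] Module.End ℝ L)
    simp only [LieHom.coe_toLinearMap, LieAlgebra.ad_apply] at this
    linear_combination (norm := module) (2⁻¹ : ℝ) • (this + hswap (fun j => T.D ⁅X, e j⁆) e)
  have h2 : ∑ j, κ j • ⁅T.D (e j), ⁅X, e j⁆⁆ = 0 := by
    have := key ((LieAlgebra.ad ℝ L : L →ₗ[ℝ] Module.End ℝ L).compl₁₂ T.D T.D)
    have hDD (j : ι) : T.D (T.D ⁅X, e j⁆) = -⁅X, e j⁆ := by
      rw [T.D_lie_of_D_eq_zero hX, T.D_lie_of_D_eq_zero hX, (T.mem_gMinusDown.1 (hmem j)).2,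
        lie_neg]
    simp only [LinearMap.compl₁₂_apply, LieHom.coe_toLinearMap, LieAlgebra.ad_apply, hDD, neg_lie,
      lie_neg, smul_neg, Finset.sum_neg_distrib] at this
    linear_combination (norm := module)
      (2⁻¹ : ℝ) • (this + hswap (fun j => ⁅X, e j⁆) fun j => T.D (e j))
  simp only [lie_sum, lie_smul, leibniz_lie X, smul_add, Finset.sum_add_distrib,
    ← T.D_lie_of_D_eq_zero hX]
  rw [h1, h2, add_zero]

end MeanCurvature

end ExtSymTriple

/-- The mean curvature vector `h` of an extrinsic symmetric triple centralizes
`g⁺ = ker D`, the `(+1)`-eigenspace of `τ = id + 2D²`. -/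
theorem meanCurvature_centralizes_gUp
    {L : Type} [LieRing L] [LieAlgebra ℝ L] [Module.Finite ℝ L]
    (T : ExtSymTriple L)
    (n : ℕ) (hn : 1 ≤ n) (hdim : n = Module.finrank ℝ T.gMinusDown)
    (e : Fin n → L) (hmem : ∀ j, e j ∈ T.gMinusDown)
    (hspan : ∀ x ∈ T.gMinusDown, x ∈ Submodule.span ℝ (Set.range e))
    (horth : ∀ i j, i ≠ j → T.B (e i) (e j) = 0)
    (κ : Fin n → ℝ) (hκ : ∀ j, T.B (e j) (e j) = κ j) (hκ1 : ∀ j, κ j = 1 ∨ κ j = -1)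
    (h : L) (hh : h = (n : ℝ)⁻¹ • ∑ j, κ j • ⁅T.D (e j), e j⁆) :
    ∀ X ∈ LinearMap.ker T.D, ⁅X, h⁆ = 0 := by
  intro X hX
  rw [LinearMap.mem_ker] at hX
  have hθX : T.D (T.theta X) = 0 := by rw [T.Dtheta, hX, map_zero, neg_zero]
  have hplus := T.lie_sum_eq_zero_of_theta_eq hmem hspan horth hκ hκ1 (X := X + T.theta X)
    (by rw [map_add, hX, hθX, add_zero]) (by rw [map_add, T.thetaInvol, add_comm])
  have hminus := T.lie_sum_eq_zero_of_theta_eq_neg hmem hspan horth hκ hκ1 (X := X - T.theta X)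
    (by rw [map_sub, hX, hθX, sub_zero]) (by rw [map_sub, T.thetaInvol, neg_sub])
  have hdecomp : X = (2⁻¹ : ℝ) • ((X + T.theta X) + (X - T.theta X)) := by module
  rw [hh, lie_smul, hdecomp, smul_lie, add_lie, hplus, hminus, add_zero, smul_zero, smul_zero]
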